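/- (Existence and uniqueness of the Stackelberg equilibrium.) Assume τ^L, τ^F > 0, ρ(x) > 0 for all x, π^ref(y|x) > 0 and ω^ref(y'|x,y) > 0 for all x, y, y'. Then the map π ↦ min_{ω} f(π,ω) over Leader policies attains its maximum at a unique Leader policy π*, and for this π* the map ω ↦ f(π*,ω) over Follower policies attains its minimum at a unique Follower policy ω*. Hence the SLHF preference-optimization problem max_π min_ω f(π,ω) has a unique solution (π*, ω*). -/

import Mathlib

/-- Kullback–Leibler divergence on a finite type, with the convention `0 · log 0 = 0`. -/
noncomputable def KLd {Y : Type*} [Fintype Y] (q ρ : Y → ℝ) : ℝ :=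
  ∑ y, q y * Real.log (q y / ρ y)

theorem KLd_eq_sum_klFun {Y : Type*} [Fintype Y] {q r : Y → ℝ} (hq : q ∈ stdSimplex ℝ Y)
    (hr : r ∈ stdSimplex ℝ Y) (hpos : ∀ y, 0 < r y) :
    KLd q r = ∑ y, r y * InformationTheory.klFun (q y / r y) := by
  have h : ∀ y, r y * InformationTheory.klFun (q y / r y)
      = q y * Real.log (q y / r y) + (r y - q y) := fun y => by
    have := (hpos y).ne'
    unfold InformationTheory.klFun
    field_simp
    ring
  simp only [h, Finset.sum_add_distrib, Finset.sum_sub_distrib, hq.2, hr.2, KLd]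
  ring

theorem mul_klFun_div_nonneg {a b : ℝ} (ha : 0 ≤ a) (hb : 0 < b) :
    0 ≤ b * InformationTheory.klFun (a / b) :=
  mul_nonneg hb.le (InformationTheory.klFun_nonneg (div_nonneg ha hb.le))

theorem KLd_nonneg {Y : Type*} [Fintype Y] {q r : Y → ℝ} (hq : q ∈ stdSimplex ℝ Y)
    (hr : r ∈ stdSimplex ℝ Y) (hpos : ∀ y, 0 < r y) : 0 ≤ KLd q r := by
  rw [KLd_eq_sum_klFun hq hr hpos]
  exact Finset.sum_nonneg fun y _ => mul_klFun_div_nonneg (hq.1 y) (hpos y)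

theorem eq_of_KLd_eq_zero {Y : Type*} [Fintype Y] {q r : Y → ℝ} (hq : q ∈ stdSimplex ℝ Y)
    (hr : r ∈ stdSimplex ℝ Y) (hpos : ∀ y, 0 < r y) (h : KLd q r = 0) : q = r := by
  rw [KLd_eq_sum_klFun hq hr hpos,
    Finset.sum_eq_zero_iff_of_nonneg fun y _ => mul_klFun_div_nonneg (hq.1 y) (hpos y)] at h
  funext y
  have hy := (mul_eq_zero.mp (h y (Finset.mem_univ y))).resolve_left (hpos y).ne'
  rwa [InformationTheory.klFun_eq_zero_iff (div_nonneg (hq.1 y) (hpos y).le),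
    div_eq_one_iff_eq (hpos y).ne'] at hy

theorem KLd_self {Y : Type*} [Fintype Y] {r : Y → ℝ} (hpos : ∀ y, 0 < r y) : KLd r r = 0 := by
  simp [KLd, fun y => div_self (hpos y).ne']

/-- Gibbs variational principle: a KL-regularized linear cost equals, up to a constant,
the scaled divergence from a Gibbs distribution of full support. -/
theorem exists_gibbs {Y : Type*} [Fintype Y] [Nonempty Y] (r c : Y → ℝ) (hpos : ∀ y, 0 < r y)
    {τ : ℝ} (hτ : 0 < τ) :
    ∃ s : Y → ℝ, ∃ v : ℝ, s ∈ stdSimplex ℝ Y ∧ (∀ y, 0 < s y) ∧ ∀ q ∈ stdSimplex ℝ Y,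
      (∑ y, q y * c y) + τ * KLd q r = v + τ * KLd q s := by
  set w : Y → ℝ := fun y => r y * Real.exp (-(c y / τ)) with hw
  have hwpos : ∀ y, 0 < w y := fun y => mul_pos (hpos y) (Real.exp_pos _)
  have hZ : 0 < ∑ y, w y := Finset.sum_pos (fun y _ => hwpos y) Finset.univ_nonempty
  have hs : ∀ y, 0 < w y / ∑ z, w z := fun y => div_pos (hwpos y) hZ
  refine ⟨fun y => w y / ∑ z, w z, -(τ * Real.log (∑ z, w z)), ⟨fun y => (hs y).le, ?_⟩, hs, ?_⟩
  · rw [← Finset.sum_div, div_self hZ.ne']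
  · intro q hq
    have hterm : ∀ y, q y * c y + τ * (q y * Real.log (q y / r y))
        = q y * -(τ * Real.log (∑ z, w z))
          + τ * (q y * Real.log (q y / (w y / ∑ z, w z))) := by
      intro y
      rcases (hq.1 y).eq_or_lt with h0 | h0
      · simp [← h0]
      · rw [Real.log_div h0.ne' (hpos y).ne', Real.log_div h0.ne' (hs y).ne',
          Real.log_div (hwpos y).ne' hZ.ne', hw, Real.log_mul (hpos y).ne' (Real.exp_pos _).ne',
          Real.log_exp]
        field_simp
        ring
    simp only [KLd, Finset.mul_sum]
    rw [← Finset.sum_add_distrib, Finset.sum_congr rfl fun y _ => hterm y,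
      Finset.sum_add_distrib, ← Finset.sum_mul, hq.2, one_mul]

/-- Existence and uniqueness of the Stackelberg equilibrium: the map
`π ↦ min_ω f(π,ω)` attains its maximum at a unique Leader policy `π*`, and for this `π*`
the map `ω ↦ f(π*,ω)` attains its minimum at a unique Follower policy `ω*`.
Here `p x y y'` denotes `p(y ≻ y' | x)`. -/
theorem stmt_4 {X Y : Type*} [Fintype X] [Fintype Y] [Nonempty X] [Nonempty Y]
    (ρ : X → ℝ) (hρ : ρ ∈ stdSimplex ℝ X) (hρpos : ∀ x, 0 < ρ x)
    (p : X → Y → Y → ℝ) (hp01 : ∀ x y y', p x y y' ∈ Set.Icc (0 : ℝ) 1)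
    (hpsym : ∀ x y y', p x y y' + p x y' y = 1)
    (τL τF : ℝ) (hτL : 0 < τL) (hτF : 0 < τF)
    (πref : X → Y → ℝ) (hπref : ∀ x, πref x ∈ stdSimplex ℝ Y)
    (hπrefpos : ∀ x y, 0 < πref x y)
    (ωref : X → Y → Y → ℝ) (hωref : ∀ x y, ωref x y ∈ stdSimplex ℝ Y)
    (hωrefpos : ∀ x y y', 0 < ωref x y y') :
    let Pi : Set (X → Y → ℝ) := {π | ∀ x, π x ∈ stdSimplex ℝ Y}
    let Om : Set (X → Y → Y → ℝ) := {ω | ∀ x y, ω x y ∈ stdSimplex ℝ Y}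
    let f : (X → Y → ℝ) → (X → Y → Y → ℝ) → ℝ := fun π ω =>
      ∑ x, ρ x * ((∑ y, π x y *
          ((∑ y', ω x y y' * p x y y') + τF * KLd (ω x y) (ωref x y)))
        - τL * KLd (π x) (πref x))
    let g : (X → Y → ℝ) → ℝ := fun π => sInf ((fun ω => f π ω) '' Om)
    -- unique maximizer of π ↦ min_ω f(π,ω)
    (∃! πs, πs ∈ Pi ∧ ∀ π ∈ Pi, g π ≤ g πs) ∧
    -- for the maximizing Leader policy, unique minimizing Follower policy
    (∀ πs, (πs ∈ Pi ∧ ∀ π ∈ Pi, g π ≤ g πs) →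
      ∃! ωs, ωs ∈ Om ∧ ∀ ω ∈ Om, f πs ωs ≤ f πs ω) := by
  intro Pi Om f g
  choose ωs v hωs hωspos hωv using fun x y => exists_gibbs (ωref x y) (p x y) (hωrefpos x y) hτF
  choose πs u hπs hπspos hπu using fun x =>
    exists_gibbs (πref x) (fun y => -v x y) (hπrefpos x) hτL
  have hf : ∀ π, ∀ ω ∈ Om, f π ω = (∑ x, ρ x * ((∑ y, π x y * v x y) - τL * KLd (π x) (πref x)))
      + ∑ x, ∑ y, ρ x * π x y * τF * KLd (ω x y) (ωs x y) := by
    intro π ω hω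
    simp only [f]
    rw [← Finset.sum_add_distrib]
    refine Finset.sum_congr rfl fun x _ => ?_
    simp only [hωv x _ _ (hω x _)]
    simp only [mul_add, mul_sub, Finset.sum_add_distrib, Finset.mul_sum,
      mul_assoc]
    ring
  have hterm : ∀ π ∈ Pi, ∀ ω ∈ Om, ∀ x y, 0 ≤ ρ x * π x y * τF * KLd (ω x y) (ωs x y) :=
    fun π hπ ω hω x y => mul_nonneg (mul_nonneg (mul_nonneg (hρpos x).le ((hπ x).1 y)) hτF.le)
      (KLd_nonneg (hω x y) (hωs x y) (hωspos x y))
  have hfs : ∀ π, f π ωs = ∑ x, ρ x * ((∑ y, π x y * v x y) - τL * KLd (π x) (πref x)) := by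
    intro π
    simp [hf π ωs hωs, fun x y => KLd_self (hωspos x y)]
  have hmin : ∀ π ∈ Pi, ∀ ω ∈ Om, f π ωs ≤ f π ω := by
    intro π hπ ω hω
    rw [hfs, hf π ω hω]
    exact le_add_of_nonneg_right
      (Finset.sum_nonneg fun x _ => Finset.sum_nonneg fun y _ => hterm π hπ ω hω x y)
  have hg : ∀ π ∈ Pi, g π = -(∑ x, ρ x * u x) - ∑ x, ρ x * (τL * KLd (π x) (πs x)) := by
    intro π hπ
    have hleast : IsLeast ((fun ω => f π ω) '' Om) (f π ωs) :=
      ⟨⟨ωs, hωs, rfl⟩, by rintro _ ⟨ω, hω, rfl⟩; exact hmin π hπ ω hω⟩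
    simp only [g]
    rw [hleast.csInf_eq, hfs, ← Finset.sum_neg_distrib, ← Finset.sum_sub_distrib]
    refine Finset.sum_congr rfl fun x _ => ?_
    have h := hπu x (π x) (hπ x)
    simp only [mul_neg, Finset.sum_neg_distrib] at h
    linear_combination -ρ x * h
  have hgterm : ∀ π ∈ Pi, ∀ x, 0 ≤ ρ x * (τL * KLd (π x) (πs x)) := fun π hπ x =>
    mul_nonneg (hρpos x).le (mul_nonneg hτL.le (KLd_nonneg (hπ x) (hπs x) (hπspos x)))
  have hgs : g πs = -(∑ x, ρ x * u x) := by
    simp [hg πs hπs, fun x => KLd_self (hπspos x)]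
  have huniq : ∀ π, (π ∈ Pi ∧ ∀ π' ∈ Pi, g π' ≤ g π) → π = πs := by
    rintro π ⟨hπ, hmax⟩
    have h := hmax πs hπs
    rw [hgs, hg π hπ] at h
    have h0 := (Finset.sum_eq_zero_iff_of_nonneg fun x _ => hgterm π hπ x).mp
      (le_antisymm (by linarith) (Finset.sum_nonneg fun x _ => hgterm π hπ x))
    funext x
    have hx := h0 x (Finset.mem_univ x)
    rw [mul_eq_zero_iff_left (hρpos x).ne', mul_eq_zero_iff_left hτL.ne'] at hx
    exact eq_of_KLd_eq_zero (hπ x) (hπs x) (hπspos x) hx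
  refine ⟨⟨πs, ⟨hπs, fun π hπ => ?_⟩, huniq⟩, fun π hπ => ?_⟩
  · rw [hgs, hg π hπ]
    exact sub_le_self _ (Finset.sum_nonneg fun x _ => hgterm π hπ x)
  · obtain rfl := huniq π hπ
    refine ⟨ωs, ⟨hωs, hmin π hπs⟩, ?_⟩
    rintro ω ⟨hω, hle⟩
    have h := hle ωs hωs
    rw [hfs, hf π ω hω] at h
    have hnn := fun x => Finset.sum_nonneg fun y (_ : y ∈ Finset.univ) => hterm π hπs ω hω x y
    have h0 := (Finset.sum_eq_zero_iff_of_nonneg fun x _ => hnn x).mp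
      (le_antisymm (by linarith) (Finset.sum_nonneg fun x _ => hnn x))
    funext x y
    have hxy := (Finset.sum_eq_zero_iff_of_nonneg fun y _ => hterm π hπs ω hω x y).mp
      (h0 x (Finset.mem_univ x)) y (Finset.mem_univ y)
    rw [mul_eq_zero_iff_left (mul_pos (mul_pos (hρpos x) (hπspos x y)) hτF).ne'] at hxy
    exact eq_of_KLd_eq_zero (hω x y) (hωs x y) (hωspos x y) hxy
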